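/- arXiv:1912.07004 — 3 statements merged into one kernel-verified Lean document; each statement's English description precedes it below -/
import Mathlib

section
/- Vertex Guard Lemma: Let G be a finite simple graph with at least two vertices and let v be a vertex of G. Then cop_1(G) ≤ cop_1(G − v) + 1, where G − v denotes the induced subgraph of G on the vertex set V(G) \ {v}. -/
/-- Positions of the 1-cop-move game with `c` cops on the simple graph `G` from
which player C (Cops) has a winning strategy.  A position consists of the cops'
locations, the robber's location, and whose turn it is (`false` = robber's turn,
`true` = cops' turn).  Player C wins if at some point a cop occupies the same
vertex as the robber. -/
inductive OneCopMoveWinPos {V : Type*} (G : SimpleGraph V) {c : ℕ} :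
    (Fin c → V) → V → Bool → Prop
  /-- A cop occupies the robber's vertex: the cops have won. -/
  | caught (cops : Fin c → V) (r : V) (turn : Bool) (i : Fin c)
      (h : cops i = r) : OneCopMoveWinPos G cops r turn
  /-- Robber's turn: the cops win if they win after every robber move
  (staying put or moving along an edge). -/
  | robberTurn (cops : Fin c → V) (r : V)
      (h : ∀ r', r' = r ∨ G.Adj r r' → OneCopMoveWinPos G cops r' true) :
      OneCopMoveWinPos G cops r false
  /-- Cops' turn: the cops win if some move of at most one cop along an edge
  (all other cops staying put) leads to a winning position. -/
  | copsTurn (cops : Fin c → V) (r : V) (cops' : Fin c → V)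
      (hmove : cops' = cops ∨
        ∃ i, G.Adj (cops i) (cops' i) ∧ ∀ j, j ≠ i → cops' j = cops j)
      (h : OneCopMoveWinPos G cops' r false) :
      OneCopMoveWinPos G cops r true

/-- Player C (Cops) has a winning strategy in the 1-cop-move game with `c`
cops on `G`: C can place the `c` cops so that, wherever player R then places
the robber (with the robber moving first thereafter), the cops win. -/
def OneCopMoveCopsWin {V : Type*} (G : SimpleGraph V) (c : ℕ) : Prop :=
  ∃ init : Fin c → V, ∀ r : V, OneCopMoveWinPos G init r false

/-- The 1-cop-move number `cop₁(G)`: the least number `c` of cops with which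
player C has a winning strategy in the 1-cop-move game on `G`. -/
noncomputable def copOne {V : Type*} (G : SimpleGraph V) : ℕ :=
  sInf {c : ℕ | OneCopMoveCopsWin G c}

/-- A winning position on `G - v` stays winning on `G` once an extra cop sits on `v`. -/
theorem OneCopMoveWinPos.cons_of_induce_compl {V : Type*} {G : SimpleGraph V} {v : V} {c : ℕ}
    {cops : Fin c → ({v}ᶜ : Set V)} {r : ({v}ᶜ : Set V)} {turn : Bool}
    (h : OneCopMoveWinPos (G.induce ({v}ᶜ : Set V)) cops r turn) :
    OneCopMoveWinPos G (Fin.cons v fun i => (cops i : V) : Fin (c + 1) → V) r turn := by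
  induction h with
  | caught cops r turn i h => exact .caught _ _ _ i.succ (by simp [h])
  | robberTurn cops r _ ih =>
    refine .robberTurn _ _ fun r' hr' => ?_
    by_cases hv : r' = v
    · exact .caught _ _ _ 0 (by simp [hv])
    · exact ih ⟨r', hv⟩ (hr'.imp Subtype.ext id)
  | copsTurn cops r cops' hmove _ ih =>
    refine .copsTurn _ _ _ ?_ ih
    obtain rfl | ⟨i, hadj, hstay⟩ := hmove
    · exact .inl rfl
    · refine .inr ⟨i.succ, by simpa using hadj, fun j => ?_⟩
      cases j using Fin.cases with
      | zero => simp
      | succ j => exact fun hj => by simp [hstay j (by simpa using hj)]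

theorem OneCopMoveCopsWin.of_induce_compl {V : Type*} {G : SimpleGraph V} {v : V} {c : ℕ}
    (h : OneCopMoveCopsWin (G.induce ({v}ᶜ : Set V)) c) : OneCopMoveCopsWin G (c + 1) := by
  obtain ⟨init, hinit⟩ := h
  refine ⟨Fin.cons v fun i => (init i : V), fun r => ?_⟩
  by_cases hv : r = v
  · exact .caught _ _ _ 0 (by simp [hv])
  · exact (hinit ⟨r, hv⟩).cons_of_induce_compl

/-- Placing a cop on every vertex wins immediately. -/
theorem oneCopMoveCopsWin_card {V : Type*} [Finite V] (G : SimpleGraph V) :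
    OneCopMoveCopsWin G (Nat.card V) :=
  ⟨(Finite.equivFin V).symm, fun r => .caught _ _ _ (Finite.equivFin V r) (by simp)⟩

theorem oneCopMoveCopsWin_copOne {V : Type*} [Finite V] (G : SimpleGraph V) :
    OneCopMoveCopsWin G (copOne G) :=
  Nat.sInf_mem (s := {c | OneCopMoveCopsWin G c}) ⟨_, oneCopMoveCopsWin_card G⟩

/-- Vertex Guard Lemma: for a finite simple graph `G` with at least two
vertices and a vertex `v` of `G`, `cop₁(G) ≤ cop₁(G − v) + 1`, where `G − v`
is the induced subgraph of `G` on the vertex set `V \ {v}`. -/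
theorem copOne_le_copOne_deleteVerts_add_one {V : Type*} [Fintype V]
    (G : SimpleGraph V) (hV : 2 ≤ Fintype.card V) (v : V) :
    copOne G ≤ copOne (G.induce ({v}ᶜ : Set V)) + 1 := by
  exact Nat.sInf_le (oneCopMoveCopsWin_copOne _).of_induce_compl
end

section
/- There exists a finite connected simple graph G with at most 720 vertices such that cop_1(G) = 4. -/
/-- The rook's graph on an `n × n` board. -/
def rookGraph (n : ℕ) : SimpleGraph (Fin n × Fin n) :=
  (⊤ : SimpleGraph (Fin n)) □ (⊤ : SimpleGraph (Fin n))

theorem rookGraph_adj {n : ℕ} {u v : Fin n × Fin n} :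
    (rookGraph n).Adj u v ↔ (u.1 ≠ v.1 ∧ u.2 = v.2) ∨ (u.2 ≠ v.2 ∧ u.1 = v.1) := by
  simp [rookGraph, SimpleGraph.boxProd_adj]

theorem rookGraph_connected (n : ℕ) [NeZero n] : (rookGraph n).Connected :=
  SimpleGraph.connected_top.boxProd SimpleGraph.connected_top

/-- `n` cops on the diagonal dominate the rook's graph, hence win. -/
theorem oneCopMoveCopsWin_rookGraph (n : ℕ) : OneCopMoveCopsWin (rookGraph n) n := by
  refine ⟨fun i => (i, i), fun r => .robberTurn _ _ fun r' _ => ?_⟩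
  by_cases h : r'.1 = r'.2
  · exact .caught _ _ _ r'.1 (Prod.ext rfl h)
  · refine .copsTurn _ _ (Function.update (fun i => (i, i)) r'.1 r') (Or.inr ⟨r'.1, ?_, ?_⟩)
      (.caught _ _ _ r'.1 (by simp))
    · simp [rookGraph_adj, h]
    · intro j hj
      simp [hj]

theorem exists_forall_ne_of_lt {c n : ℕ} (hc : c < n) (f : Fin c → Fin n) :
    ∃ y, ∀ i, f i ≠ y := by
  by_contra! h
  have := Fintype.card_le_of_surjective f h
  simp only [Fintype.card_fin] at this
  omega

/-- With fewer than `n` cops, the robber is safe on the cops' turn as long as no cop shares a row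
or a column with the robber, and safe on the robber's turn as long as no cop shares a row or no
cop shares a column with the robber. -/
theorem OneCopMoveWinPos.not_safe_rookGraph {c n : ℕ} (hc : c < n) {cops : Fin c → Fin n × Fin n}
    {r : Fin n × Fin n} {turn : Bool} (hwin : OneCopMoveWinPos (rookGraph n) cops r turn) :
    (turn = false → ¬((∀ i, (cops i).1 ≠ r.1) ∨ (∀ i, (cops i).2 ≠ r.2))) ∧
      (turn = true → ¬((∀ i, (cops i).1 ≠ r.1) ∧ (∀ i, (cops i).2 ≠ r.2))) := by
  induction hwin with
  | caught cops r turn i h =>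
    subst h
    exact ⟨fun _ hs => hs.elim (fun hs => hs i rfl) fun hs => hs i rfl, fun _ hs => hs.1 i rfl⟩
  | robberTurn cops r h ih =>
    refine ⟨fun _ hs => ?_, nofun⟩
    rcases hs with hs | hs
    · obtain ⟨y, hy⟩ := exists_forall_ne_of_lt hc fun i => (cops i).2
      refine (ih (r.1, y) ?_).2 rfl ⟨hs, hy⟩
      by_cases hr : r.2 = y
      · exact Or.inl (Prod.ext rfl hr.symm)
      · exact Or.inr (rookGraph_adj.2 (Or.inr ⟨hr, rfl⟩))
    · obtain ⟨x, hx⟩ := exists_forall_ne_of_lt hc fun i => (cops i).1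
      refine (ih (x, r.2) ?_).2 rfl ⟨hx, hs⟩
      by_cases hr : r.1 = x
      · exact Or.inl (Prod.ext hr.symm rfl)
      · exact Or.inr (rookGraph_adj.2 (Or.inl ⟨hr, rfl⟩))
  | copsTurn cops r cops' hmove h ih =>
    refine ⟨nofun, fun _ hs => ih.1 rfl ?_⟩
    rcases hmove with rfl | ⟨i, hadj, hstay⟩
    · exact Or.inl hs.1
    · rcases rookGraph_adj.1 hadj with ⟨-, heq⟩ | ⟨-, heq⟩
      · refine Or.inr fun j => ?_
        by_cases hj : j = i
        · subst hj
          exact heq ▸ hs.2 j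
        · exact hstay j hj ▸ hs.2 j
      · refine Or.inl fun j => ?_
        by_cases hj : j = i
        · subst hj
          exact heq ▸ hs.1 j
        · exact hstay j hj ▸ hs.1 j

theorem not_oneCopMoveCopsWin_rookGraph {c n : ℕ} (hc : c < n) :
    ¬OneCopMoveCopsWin (rookGraph n) c := by
  rintro ⟨init, hinit⟩
  obtain ⟨x, hx⟩ := exists_forall_ne_of_lt hc fun i => (init i).1
  exact ((hinit (x, x)).not_safe_rookGraph hc).1 rfl (Or.inl hx)

theorem copOne_rookGraph (n : ℕ) : copOne (rookGraph n) = n :=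
  le_antisymm (Nat.sInf_le (oneCopMoveCopsWin_rookGraph n))
    (le_csInf ⟨n, oneCopMoveCopsWin_rookGraph n⟩ fun _ hc =>
      not_lt.1 fun hlt => not_oneCopMoveCopsWin_rookGraph hlt hc)

/-- There exists a finite connected simple graph with at most 720 vertices
whose 1-cop-move number is exactly 4. -/
theorem exists_connected_graph_card_le_720_copOne_eq_four :
    ∃ (V : Type) (inst : Fintype V) (G : SimpleGraph V),
      G.Connected ∧ @Fintype.card V inst ≤ 720 ∧ copOne G = 4 :=
  ⟨Fin 4 × Fin 4, inferInstance, rookGraph 4, rookGraph_connected 4, by simp, copOne_rookGraph 4⟩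
end

section
/- Let G be a finite connected simple graph and let c be a positive integer with c ≤ cop_1(G). Then there exists a set S of vertices of G such that the induced subgraph H of G on S is connected and cop_1(H) = c. -/
/-- Guards that never move can protect the vertices outside an induced subgraph: a winning position
in an induced copy of `H` in `G` remains winning in `G` once every vertex outside that copy is
occupied by an additional cop. -/
theorem OneCopMoveWinPos.append {V W : Type*} {G : SimpleGraph V} {H : SimpleGraph W} (f : H ↪g G)
    {d c : ℕ} (guards : Fin d → V) (hf : ∀ x, x ∈ Set.range guards ∨ x ∈ Set.range f)
    {cops : Fin c → W} {r : W} {turn : Bool} (h : OneCopMoveWinPos H cops r turn) :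
    OneCopMoveWinPos G (Fin.append guards (f ∘ cops)) (f r) turn := by
  induction h with
  | caught cops r turn i h => exact .caught _ _ _ (i.natAdd d) (by simp [h])
  | robberTurn cops r _ ih =>
    refine .robberTurn _ _ fun r' hr' => ?_
    rcases hf r' with ⟨i, hi⟩ | ⟨s, rfl⟩
    · exact .caught _ _ _ (i.castAdd c) (by simp [hi])
    · exact ih s (hr'.imp (fun e => f.injective e) f.map_adj_iff.1)
  | copsTurn cops r cops' hmove _ ih =>
    refine .copsTurn _ _ _ ?_ ih
    rcases hmove with rfl | ⟨i, hi, hj⟩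
    · exact .inl rfl
    · refine .inr ⟨i.natAdd d, by simpa using hi, fun j => ?_⟩
      refine Fin.addCases (fun _ _ => by simp) (fun k hk => ?_) j
      simp [hj k fun e => hk (congrArg (Fin.natAdd d) e)]

theorem OneCopMoveCopsWin.append {V W : Type*} {G : SimpleGraph V} {H : SimpleGraph W}
    (f : H ↪g G) {d c : ℕ} (guards : Fin d → V)
    (hf : ∀ x, x ∈ Set.range guards ∨ x ∈ Set.range f) (h : OneCopMoveCopsWin H c) :
    OneCopMoveCopsWin G (d + c) := by
  obtain ⟨init, hinit⟩ := h
  refine ⟨Fin.append guards (f ∘ init), fun r => ?_⟩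
  rcases hf r with ⟨i, hi⟩ | ⟨s, rfl⟩
  · exact .caught _ _ _ (i.castAdd c) (by simp [hi])
  · exact (hinit s).append f guards hf

theorem oneCopMoveCopsWin_of_surjective {V : Type*} (G : SimpleGraph V) {c : ℕ} {init : Fin c → V}
    (h : Function.Surjective init) : OneCopMoveCopsWin G c :=
  ⟨init, fun r => (h r).elim fun i hi => .caught _ _ _ i hi⟩

theorem copOne_le_add_copOne {V W : Type*} [Finite W] {G : SimpleGraph V} {H : SimpleGraph W}
    (f : H ↪g G) {d : ℕ} (guards : Fin d → V)
    (hf : ∀ x, x ∈ Set.range guards ∨ x ∈ Set.range f) : copOne G ≤ d + copOne H :=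
  Nat.sInf_le ((oneCopMoveCopsWin_copOne H).append f guards hf)

theorem copOne_le_one_of_subsingleton {V : Type*} [Nonempty V] [Subsingleton V]
    (G : SimpleGraph V) : copOne G ≤ 1 :=
  Nat.sInf_le (oneCopMoveCopsWin_of_surjective G (init := fun _ : Fin 1 => Classical.arbitrary V)
    fun _ => ⟨0, Subsingleton.elim _ _⟩)

/-- A connected induced subgraph with at least two vertices has a vertex whose deletion keeps it
connected and decreases the 1-cop-move number by at most one. -/
theorem exists_ssubset_connected_copOne_le {V : Type*} [Finite V] {G : SimpleGraph V} {S : Set V}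
    (hS : (G.induce S).Connected) [Nontrivial S] :
    ∃ T ⊂ S, (G.induce T).Connected ∧ copOne (G.induce S) ≤ 1 + copOne (G.induce T) := by
  obtain ⟨v, hv⟩ := hS.exists_connected_induce_compl_singleton_of_finite_nontrivial
  refine ⟨S \ {v.1}, Set.sdiff_singleton_ssubset.2 v.2, ?_, ?_⟩
  · let f : (G.induce S).induce {v}ᶜ →g G.induce (S \ {v.1}) :=
      { toFun := fun x => ⟨x.1.1, x.1.2, fun h => x.2 (Subtype.ext h)⟩
        map_rel' := fun h => h }
    exact hv.map f fun x => ⟨⟨⟨x.1, x.2.1⟩, fun h => x.2.2 (congrArg Subtype.val h)⟩, rfl⟩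
  · refine copOne_le_add_copOne (G.induceHomOfLE Set.sdiff_subset) (fun _ : Fin 1 => v) fun x => ?_
    by_cases hx : x = v
    · exact .inl ⟨0, hx.symm⟩
    · exact .inr ⟨⟨x.1, x.2, fun h => hx (Subtype.ext h)⟩, rfl⟩

/-- Every value `c` with `1 ≤ c ≤ cop₁(G)` is attained as the 1-cop-move
number of some connected induced subgraph of a finite connected simple
graph `G`. -/
theorem exists_connected_induced_subgraph_copOne_eq {V : Type*} [Fintype V]
    (G : SimpleGraph V) (hG : G.Connected) (c : ℕ) (hc1 : 1 ≤ c)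
    (hc2 : c ≤ copOne G) :
    ∃ S : Set V, (G.induce S).Connected ∧ copOne (G.induce S) = c := by
  let P : Set V → Prop := fun S => (G.induce S).Connected ∧ c ≤ copOne (G.induce S)
  have huniv : P Set.univ := by
    refine ⟨(SimpleGraph.induceUnivIso G).connected_iff.2 hG, hc2.trans ?_⟩
    simpa using copOne_le_add_copOne (SimpleGraph.induceUnivIso G).toEmbedding Fin.elim0
      fun x => .inr ⟨⟨x, trivial⟩, rfl⟩
  obtain ⟨S, hS⟩ := Set.Finite.exists_minimal (Set.toFinite {S | P S}) ⟨_, huniv⟩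
  obtain ⟨hconn, hle⟩ := hS.prop
  refine ⟨S, hconn, le_antisymm ?_ hle⟩
  by_contra! hlt
  have := hconn.nonempty
  have : Nontrivial S := by
    by_contra hn
    rw [not_nontrivial_iff_subsingleton] at hn
    have := copOne_le_one_of_subsingleton (G.induce S)
    omega
  obtain ⟨T, hTS, hT, hcop⟩ := exists_ssubset_connected_copOne_le hconn
  exact hS.not_prop_of_lt hTS ⟨hT, by omega⟩
end
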